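/- For every even integer k ≥ 10, the graph G_k is bipartite, i.e., 2-colorable. -/

import Mathlib

open SimpleGraph

/-- Vertex type of the graph `H_k`: four disjoint families
`b_i` (`i` mod `k`), `u_j` (`j` mod `3k`), `v_j` (`j` mod `3k`), `a_i` (`i` mod `k`). -/
inductive HkV (k : ℕ) : Type where
  | b : ZMod k → HkV k
  | u : ZMod (3 * k) → HkV k
  | v : ZMod (3 * k) → HkV k
  | a : ZMod k → HkV k
deriving DecidableEq

/-- The natural map sending the residue `i` mod `k` to the residue `3 i` mod `3 k`. -/
def HkV.tr (k : ℕ) (i : ZMod k) : ZMod (3 * k) := 3 * (i.val : ZMod (3 * k))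

/-- The base edge relation of `H_k`: the four cycles
`b_1 ⋯ b_k`, `u_1 ⋯ u_{3k}`, `v_1 ⋯ v_{3k}`, `a_1 ⋯ a_k`, together with the edges
`b_i u_{3i-2}`, `b_i u_{3i}`, `b_i u_{3i+2}`, the edges `u_j v_{j-1}`, `u_j v_{j+1}`,
and the edges `a_i v_{3i-2}`, `a_i v_{3i}`, `a_i v_{3i+2}` (indices modulo `k`
resp. `3k`). -/
def hkRel (k : ℕ) : HkV k → HkV k → Prop
  | .b i, .b i' => i' = i + 1
  | .u j, .u j' => j' = j + 1
  | .v j, .v j' => j' = j + 1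
  | .a i, .a i' => i' = i + 1
  | .b i, .u j => j = HkV.tr k i - 2 ∨ j = HkV.tr k i ∨ j = HkV.tr k i + 2
  | .u j, .v j' => j' = j - 1 ∨ j' = j + 1
  | .a i, .v j => j = HkV.tr k i - 2 ∨ j = HkV.tr k i ∨ j = HkV.tr k i + 2
  | _, _ => False

/-- The graph `H_k` from the paper. -/
def Hk (k : ℕ) : SimpleGraph (HkV k) := SimpleGraph.fromRel (hkRel k)
/-- The base edge relation of `G_k`: the relation of `H_k` on the old vertices, together
with edges joining the new vertex (`none`) to `b_1, b_3, b_5, b_7, b_9`. -/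
def gkRel (k : ℕ) : Option (HkV k) → Option (HkV k) → Prop
  | some x, some y => hkRel k x y
  | none, some (.b i) => i = 1 ∨ i = 3 ∨ i = 5 ∨ i = 7 ∨ i = 9
  | _, _ => False

/-- The graph `G_k` from the paper: `H_k` together with one new vertex `w = none` whose
neighborhood is exactly `{b_1, b_3, b_5, b_7, b_9}`. -/
def Gk (k : ℕ) : SimpleGraph (Option (HkV k)) := SimpleGraph.fromRel (gkRel k)

/-- For even `k`, the parity of `3 i` mod `3 k` is the parity of `i` mod `k`. -/
theorem HkV.castHom_tr {k : ℕ} [NeZero k] (h : 2 ∣ k) (h3 : 2 ∣ 3 * k) (i : ZMod k) :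
    ZMod.castHom h3 (ZMod 2) (HkV.tr k i) = ZMod.castHom h (ZMod 2) i := by
  have hi : ZMod.castHom h (ZMod 2) i = (i.val : ZMod 2) := by
    rw [← map_natCast (ZMod.castHom h (ZMod 2)), ZMod.natCast_zmod_val]
  have three : (3 : ZMod 2) = 1 := rfl
  rw [hi, HkV.tr, map_mul, map_natCast, map_ofNat, three, one_mul]

/-- The proper `2`-coloring of `G_k` for even `k`. -/
def gkColor {k : ℕ} (h : 2 ∣ k) : Option (HkV k) → ZMod 2
  | none => 0
  | some (.b i) => ZMod.castHom h (ZMod 2) i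
  | some (.u j) => ZMod.castHom (h.mul_left 3) (ZMod 2) j + 1
  | some (.v j) => ZMod.castHom (h.mul_left 3) (ZMod 2) j + 1
  | some (.a i) => ZMod.castHom h (ZMod 2) i

theorem gkColor_eq_add_one {k : ℕ} [NeZero k] (h : 2 ∣ k) {x y : Option (HkV k)}
    (hxy : gkRel k x y) : gkColor h y = gkColor h x + 1 := by
  have parity : ∀ c : ZMod 2, c - 1 = c + 1 ∧ c - 2 = c ∧ c + 2 = c := by decide
  have odd : (3 : ZMod 2) = 1 ∧ (5 : ZMod 2) = 1 ∧ (7 : ZMod 2) = 1 ∧ (9 : ZMod 2) = 1 := by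
    decide
  obtain ⟨three, five, seven, nine⟩ := odd
  rcases x with _ | (i | i | i | i) <;> rcases y with _ | (j | j | j | j) <;>
    simp only [gkRel, hkRel] at hxy <;> (try rcases hxy with rfl | rfl | rfl | rfl | rfl) <;>
    simp only [gkColor, map_add, map_sub, map_one, map_ofNat, HkV.castHom_tr h, parity,
      three, five, seven, nine, zero_add]

/-- for every even integer `k ≥ 10`, the graph `G_k` is bipartite,
i.e. 2-colorable. -/
theorem Gk_bipartite (k : ℕ) (hk : 10 ≤ k) (hke : Even k) :
    (Gk k).Colorable 2 := by
  have : NeZero k := ⟨by omega⟩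
  refine ⟨Coloring.mk (gkColor hke.two_dvd) fun {x y} hxy => ?_⟩
  have ne_add_one : ∀ c : ZMod 2, c ≠ c + 1 := by decide
  rcases ((fromRel_adj _ _ _).1 hxy).2 with hr | hr
  · rw [gkColor_eq_add_one hke.two_dvd hr]
    exact ne_add_one _
  · rw [gkColor_eq_add_one hke.two_dvd hr]
    exact (ne_add_one _).symm
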